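/- Assume μ is a stationary ergodic probability measure on {0,1}^ℤ with q := μ(C(0) = 1) ∈ (0,1]. For the random walk in random environment Z(n) = (X(n), Y(n)) with annealed law P, let n_x(n) := |{0 ≤ m < n : X(m+1) ≠ X(m)}| and n_y(n) := |{0 ≤ m < n : Y(m+1) ≠ Y(m)}| be the total numbers of horizontal and vertical steps among the first n steps. Then, P-almost surely, n_x(n)/n → 1/(1+q) and n_y(n)/n → q/(1+q) as n → ∞. -/

import Mathlib

open MeasureTheory ProbabilityTheory Filter Set

noncomputable section

/-- The shift on environments `{0,1}^ℤ` (stationarity and ergodicity of the environment law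
are stated with respect to this map). -/
def envShift (C : ℤ → Bool) : ℤ → Bool := fun x => C (x + 1)

/-- Quenched one-step transition probabilities of the nearest-neighbour random walk in the
random environment: in a connected column (`b = true`) each of the four neighbours is chosen
with probability `1/4`; in a non-connected column (`b = false`) each horizontal neighbour is
chosen with probability `1/2`. -/
def rwreStep (b : Bool) (z w : ℤ × ℤ) : ℝ :=
  if b then
    (if w = (z.1 + 1, z.2) ∨ w = (z.1 - 1, z.2) ∨
        w = (z.1, z.2 + 1) ∨ w = (z.1, z.2 - 1) then 1 / 4 else 0)
  else
    (if w = (z.1 + 1, z.2) ∨ w = (z.1 - 1, z.2) then 1 / 2 else 0)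

/-- `(E, Z)` is a copy (under the annealed law `P = ∫ P_C μ(dC)`) of the random walk in
random environment: `E` is the environment, with law `μ`, `Z` starts at the origin, and given
any environment event fixing the column type at the current position, the walk makes its next
step according to the quenched transition probabilities `rwreStep`. -/
def IsRWRE {Ω : Type*} [MeasurableSpace Ω] (P : Measure Ω) (μ : Measure (ℤ → Bool))
    (E : Ω → ℤ → Bool) (Z : ℕ → Ω → ℤ × ℤ) : Prop :=
  Measurable E ∧ (∀ n, Measurable (Z n)) ∧ P.map E = μ ∧
  (∀ᵐ ω ∂P, Z 0 ω = (0, 0)) ∧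
  ∀ (n : ℕ) (f : ℕ → ℤ × ℤ) (w : ℤ × ℤ) (b : Bool) (A : Set (ℤ → Bool)),
    MeasurableSet A → (∀ C ∈ A, C (f n).1 = b) →
    P {ω | E ω ∈ A ∧ (∀ i ≤ n, Z i ω = f i) ∧ Z (n + 1) ω = w}
      = ENNReal.ofReal (rwreStep b (f n) w) * P {ω | E ω ∈ A ∧ ∀ i ≤ n, Z i ω = f i}


/-- `n_x(n)`: the number of horizontal steps among the first `n` steps of the walk `Z`. -/
def nxSteps {Ω : Type*} (Z : ℕ → Ω → ℤ × ℤ) (n : ℕ) (ω : Ω) : ℕ :=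
  ((Finset.range n).filter fun m => (Z (m + 1) ω).1 ≠ (Z m ω).1).card

/-- `n_y(n)`: the number of vertical steps among the first `n` steps of the walk `Z`. -/
def nySteps {Ω : Type*} (Z : ℕ → Ω → ℤ × ℤ) (n : ℕ) (ω : Ω) : ℕ :=
  ((Finset.range n).filter fun m => (Z (m + 1) ω).2 ≠ (Z m ω).2).card

/-- Running maximum functional of the Birkhoff sums. -/
def runMax {α : Type*} (T : α → α) (φ : α → ℝ) : ℕ → α → ℝ
  | 0, _ => 0
  | n + 1, x => max 0 (φ x + runMax T φ n (T x))

theorem runMax_nonneg {α : Type*} (T : α → α) (φ : α → ℝ) (n : ℕ) (x : α) :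
    0 ≤ runMax T φ n x := by
  cases n with
  | zero => exact le_rfl
  | succ n => exact le_max_left _ _

theorem runMax_le_succ {α : Type*} (T : α → α) (φ : α → ℝ) (n : ℕ) (x : α) :
    runMax T φ n x ≤ runMax T φ (n + 1) x := by
  induction n generalizing x with
  | zero => exact runMax_nonneg _ _ _ _
  | succ n ih =>
    have := ih (T x)
    simp only [runMax] at this ⊢
    gcongr

theorem birkhoffSum_le_runMax {α : Type*} (T : α → α) (φ : α → ℝ) (n : ℕ) (x : α) :
    birkhoffSum T φ n x ≤ runMax T φ n x := by
  induction n generalizing x with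
  | zero => simp [runMax]
  | succ n ih =>
    rw [birkhoffSum_succ']
    exact le_trans (by gcongr; exact ih _) (le_max_right _ _)

theorem runMax_measurable {α : Type*} [MeasurableSpace α] {T : α → α} {φ : α → ℝ}
    (hT : Measurable T) (hφ : Measurable φ) (n : ℕ) : Measurable (runMax T φ n) := by
  induction n with
  | zero => exact measurable_const
  | succ n ih => exact measurable_const.max (hφ.add (ih.comp hT))

theorem runMax_integrable {α : Type*} [MeasurableSpace α] {m : Measure α} [IsFiniteMeasure m]
    {T : α → α} {φ : α → ℝ} (hT : MeasurePreserving T m m) (hi : Integrable φ m) (n : ℕ) :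
    Integrable (runMax T φ n) m := by
  induction n with
  | zero => exact integrable_zero _ _ _
  | succ n ih =>
    exact (integrable_zero _ _ _).sup (hi.add (hT.integrable_comp_of_integrable ih))

theorem runMax_bdd_iff {α : Type*} (T : α → α) (φ : α → ℝ) (x : α) :
    BddAbove (range fun n => runMax T φ n (T x)) ↔ BddAbove (range fun n => runMax T φ n x) := by
  constructor
  · rintro ⟨b, hb⟩
    refine ⟨max 0 (φ x + b), ?_⟩
    rintro _ ⟨n, rfl⟩
    refine (runMax_le_succ T φ n x).trans ?_
    have := hb ⟨n, rfl⟩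
    simp only [runMax] at this ⊢
    gcongr
  · rintro ⟨b, hb⟩
    refine ⟨b - φ x, ?_⟩
    rintro _ ⟨n, rfl⟩
    have h1 : runMax T φ (n + 1) x ≤ b := hb ⟨n + 1, rfl⟩
    have h2 : φ x + runMax T φ n (T x) ≤ runMax T φ (n + 1) x := le_max_right _ _
    dsimp only
    linarith

theorem ae_bddAbove_of_integral_neg {α : Type*} [MeasurableSpace α] {m : Measure α}
    [IsFiniteMeasure m] {T : α → α} {φ : α → ℝ} (hT : Ergodic T m) (hφ : Measurable φ)
    (hi : Integrable φ m) (hneg : ∫ x, φ x ∂m < 0) :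
    ∀ᵐ x ∂m, BddAbove (range fun n => birkhoffSum T φ n x) := by
  have hTm := hT.measurable
  set A : Set α := {x | BddAbove (range fun n => runMax T φ n x)} with hA
  have hAm : MeasurableSet A := measurableSet_bddAbove_range (runMax_measurable hTm hφ)
  have hAi : T ⁻¹' A = A := by
    ext x; exact runMax_bdd_iff T φ x
  rcases eventuallyConst_set'.1 (hT.toPreErgodic.aeconst_set hAm hAi) with h | h
  · exfalso
    have hunb : ∀ᵐ x ∂m, x ∉ A := by
      filter_upwards [h] with x hx hxA
      have : (x ∈ A) = (x ∈ (∅ : Set α)) := hx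
      rw [this] at hxA
      exact hxA
    have hlim : Tendsto (fun n => ∫ x, (runMax T φ (n + 1) x - runMax T φ n (T x)) ∂m) atTop
        (nhds (∫ x, φ x ∂m)) := by
      refine tendsto_integral_of_dominated_convergence (fun x => |φ x|) ?_ hi.abs ?_ ?_
      · intro n
        exact ((runMax_measurable hTm hφ _).sub
          ((runMax_measurable hTm hφ _).comp hTm)).aestronglyMeasurable
      · intro n
        refine ae_of_all _ fun x => ?_
        have h0 := runMax_nonneg T φ n (T x)
        simp only [runMax, Real.norm_eq_abs]
        rcases le_total 0 (φ x + runMax T φ n (T x)) with h1 | h1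
        · rw [max_eq_right h1]; simp
        · rw [max_eq_left h1]
          rw [zero_sub, abs_neg, abs_of_nonneg h0, abs_of_nonpos (by linarith)]
          linarith
      · filter_upwards [hunb] with x hx
        have hx' : ¬ BddAbove (range fun n => runMax T φ n (T x)) := by
          rw [runMax_bdd_iff]; exact hx
        have hmono : Monotone fun n => runMax T φ n (T x) :=
          monotone_nat_of_le_succ fun n => runMax_le_succ T φ n _
        have htop := tendsto_atTop_atTop_of_monotone' hmono hx'
        refine tendsto_const_nhds.congr' ?_
        filter_upwards [htop.eventually_ge_atTop (-φ x)] with n hn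
        simp only [runMax]
        rw [max_eq_right (by linarith)]; ring
    have hge : ∀ n, 0 ≤ ∫ x, (runMax T φ (n + 1) x - runMax T φ n (T x)) ∂m := by
      intro n
      have i1 := runMax_integrable hT.toMeasurePreserving hi n
      have i2 := runMax_integrable hT.toMeasurePreserving hi (n + 1)
      have i3 : Integrable (fun x => runMax T φ n (T x)) m :=
        hT.toMeasurePreserving.integrable_comp_of_integrable i1
      rw [integral_sub i2 i3]
      have e : ∫ x, runMax T φ n (T x) ∂m = ∫ x, runMax T φ n x ∂m := by
        have hmap := hT.toMeasurePreserving.map_eq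
        conv_rhs => rw [← hmap]
        rw [integral_map hTm.aemeasurable
          (runMax_measurable hTm hφ n).aestronglyMeasurable]
      have := integral_mono i1 i2 (fun x => runMax_le_succ T φ n x)
      rw [e]
      linarith
    have := ge_of_tendsto' hlim hge
    linarith
  · filter_upwards [h] with x hx
    have hxA : x ∈ A := by
      have : (x ∈ A) = (x ∈ (univ : Set α)) := hx
      rw [this]; trivial
    obtain ⟨b, hb⟩ := hxA
    refine ⟨b, ?_⟩
    rintro _ ⟨n, rfl⟩
    exact (birkhoffSum_le_runMax T φ n x).trans (hb ⟨n, rfl⟩)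

theorem ae_eventually_le_of_integral {α : Type*} [MeasurableSpace α] {m : Measure α}
    [IsFiniteMeasure m] {T : α → α} {φ : α → ℝ} (hT : Ergodic T m) (hφ : Measurable φ)
    (hi : Integrable φ m) (c : ℝ) (hm : m univ ≠ 0) (hc : ∫ x, φ x ∂m = c * m.real univ)
    (ε : ℝ) (hε : 0 < ε) :
    ∀ᵐ x ∂m, ∀ᶠ n : ℕ in atTop, birkhoffSum T φ n x / n < c + ε := by
  have hpos : 0 < m.real univ := ENNReal.toReal_pos hm (measure_ne_top _ _)
  have hnegint : ∫ x, (φ x - (c + ε / 2)) ∂m < 0 := by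
    rw [integral_sub hi (integrable_const _), integral_const, hc, smul_eq_mul]
    nlinarith
  have key := ae_bddAbove_of_integral_neg hT (hφ.sub_const (c + ε / 2))
    (hi.sub (integrable_const _)) hnegint
  filter_upwards [key] with x hx
  obtain ⟨b, hb⟩ := hx
  have hlim : ∀ᶠ n : ℕ in atTop, b < n * (ε / 2) :=
    (tendsto_natCast_atTop_atTop.atTop_mul_const (half_pos hε)).eventually_gt_atTop b
  filter_upwards [hlim, eventually_gt_atTop 0] with n hn hn0
  have hn0' : (0 : ℝ) < n := by exact_mod_cast hn0
  have h1 := hb ⟨n, rfl⟩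
  simp only [birkhoffSum, Finset.sum_sub_distrib, Finset.sum_const, Finset.card_range,
    nsmul_eq_mul] at h1
  rw [div_lt_iff₀ hn0']
  simp only [birkhoffSum]
  linarith

/-- Pointwise ergodic theorem for an ergodic transformation. -/
theorem ae_tendsto_birkhoff {α : Type*} [MeasurableSpace α] {m : Measure α}
    [IsFiniteMeasure m] {T : α → α} {φ : α → ℝ} (hT : Ergodic T m) (hφ : Measurable φ)
    (hi : Integrable φ m) (c : ℝ) (hm : m univ ≠ 0) (hc : ∫ x, φ x ∂m = c * m.real univ) :
    ∀ᵐ x ∂m, Tendsto (fun n : ℕ => birkhoffSum T φ n x / n) atTop (nhds c) := by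
  have h1 : ∀ k : ℕ, ∀ᵐ x ∂m, ∀ᶠ n : ℕ in atTop,
      birkhoffSum T φ n x / n < c + 1 / ((k : ℝ) + 1) := fun k =>
    ae_eventually_le_of_integral hT hφ hi c hm hc _ (by positivity)
  have h2 : ∀ k : ℕ, ∀ᵐ x ∂m, ∀ᶠ n : ℕ in atTop,
      birkhoffSum T (fun x => - φ x) n x / n < -c + 1 / ((k : ℝ) + 1) := fun k =>
    ae_eventually_le_of_integral hT hφ.neg hi.neg (-c) hm
      (by
        have : ∫ x, (-φ) x ∂m = - ∫ x, φ x ∂m := integral_neg φ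
        rw [this, hc]; ring) _ (by positivity)
  filter_upwards [ae_all_iff.2 h1, ae_all_iff.2 h2] with x hx1 hx2
  rw [Metric.tendsto_nhds]
  intro ε hε
  obtain ⟨k, hk⟩ := exists_nat_one_div_lt hε
  filter_upwards [hx1 k, hx2 k] with n hn1 hn2
  have : birkhoffSum T (fun x => - φ x) n x = - birkhoffSum T φ n x := by
    simp [birkhoffSum]
  rw [this, neg_div] at hn2
  rw [Real.dist_eq, abs_lt]
  constructor <;> linarith

/-- Uniform law on four letters. -/
def unifFour : Measure (Fin 4) := (4 : ENNReal)⁻¹ • Measure.count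

instance : IsProbabilityMeasure unifFour := ⟨by
  simp only [unifFour, Measure.smul_apply, smul_eq_mul, Measure.count_univ]
  simp
  exact ENNReal.inv_mul_cancel (by norm_num) (by norm_num)⟩

/-- Law of an i.i.d. uniform sequence of letters. -/
def coinLaw : Measure (ℕ → Fin 4) := Measure.infinitePi fun _ => unifFour

instance : IsProbabilityMeasure coinLaw := by unfold coinLaw; infer_instance

/-- Prepend a letter to a sequence. -/
def scons (u : Fin 4) (U : ℕ → Fin 4) : ℕ → Fin 4
  | 0 => u
  | n + 1 => U n

theorem measurable_scons : Measurable fun p : Fin 4 × (ℕ → Fin 4) => scons p.1 p.2 := by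
  refine measurable_pi_lambda _ fun n => ?_
  cases n with
  | zero => exact measurable_fst
  | succ n => exact (measurable_pi_apply n).comp measurable_snd

theorem measurable_scons' (u : Fin 4) : Measurable (scons u) :=
  measurable_scons.comp (measurable_const.prodMk measurable_id)

theorem map_scons : (unifFour.prod coinLaw).map (fun p => scons p.1 p.2) = coinLaw := by
  classical
  refine Measure.eq_infinitePi _ fun s t ht => ?_
  obtain ⟨N, hN⟩ := s.exists_nat_subset_range
  have hN' : s ⊆ Finset.range (N + 1) := hN.trans (Finset.range_mono (Nat.le_succ N))
  set t' : ℕ → Set (Fin 4) := fun i => if i ∈ s then t i else univ with ht'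
  have htmeas : ∀ i, MeasurableSet (t' i) := fun i => by
    simp only [ht']; split_ifs
    · exact ht i
    · exact MeasurableSet.univ
  have hprod : ∏ i ∈ s, unifFour (t i) = ∏ i ∈ Finset.range (N + 1), unifFour (t' i) := by
    rw [← Finset.prod_subset hN']
    · refine Finset.prod_congr rfl fun i hi => ?_
      simp [ht', hi]
    · intro i _ hi
      simp [ht', hi]
  have hset : (s : Set ℕ).pi t = ((Finset.range (N + 1) : Finset ℕ) : Set ℕ).pi t' := by
    ext U
    simp only [Set.mem_pi, Finset.mem_coe, ht']
    constructor
    · intro h i _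
      split_ifs with hi
      · exact h i hi
      · trivial
    · intro h i hi
      have := h i (hN' hi)
      simpa [hi] using this
  rw [hprod, hset, Measure.map_apply measurable_scons
    (MeasurableSet.pi (Finset.countable_toSet _) fun i _ => htmeas i)]
  have hpre : (fun p : Fin 4 × (ℕ → Fin 4) => scons p.1 p.2) ⁻¹'
      ((Finset.range (N + 1) : Finset ℕ) : Set ℕ).pi t'
      = t' 0 ×ˢ ((Finset.range N : Finset ℕ) : Set ℕ).pi (fun i => t' (i + 1)) := by
    ext ⟨u, U⟩
    simp only [Set.mem_preimage, Set.mem_pi, Finset.mem_coe, Finset.mem_range, Set.mem_prod]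
    constructor
    · intro h
      exact ⟨h 0 (Nat.succ_pos _), fun i hi => h (i + 1) (by omega)⟩
    · rintro ⟨h0, h⟩ i hi
      cases i with
      | zero => exact h0
      | succ i => exact h i (by omega)
  rw [hpre, Measure.prod_prod, Finset.prod_range_succ', mul_comm]
  congr 1
  exact Measure.infinitePi_pi _ fun i _ => htmeas _

theorem coinLaw_apply {B : Set (ℕ → Fin 4)} (hB : MeasurableSet B) :
    coinLaw B = ∑ u : Fin 4, (4 : ENNReal)⁻¹ * coinLaw (scons u ⁻¹' B) := by
  conv_lhs => rw [← map_scons]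
  rw [Measure.map_apply measurable_scons hB, Measure.prod_apply (measurable_scons hB)]
  simp only [unifFour]
  rw [lintegral_smul_measure, lintegral_count, tsum_fintype, smul_eq_mul, Finset.mul_sum]
  rfl

/-- Translation of environments. -/
def envTr (k : ℤ) (C : ℤ → Bool) : ℤ → Bool := fun x => C (x + k)

/-- The displacement in a column of type `b` when the letter `u` is drawn. -/
def dstep (b : Bool) (u : Fin 4) : ℤ × ℤ :=
  if u = 0 then (1, 0) else if u = 1 then (-1, 0)
  else if u = 2 then (if b then (0, 1) else (1, 0))
  else (if b then (0, -1) else (-1, 0))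

/-- The skew product describing the environment seen from the walker. -/
def skew (p : (ℕ → Fin 4) × (ℤ → Bool)) : (ℕ → Fin 4) × (ℤ → Bool) :=
  (fun n => p.1 (n + 1), envTr (dstep (p.2 0) (p.1 0)).1 p.2)

theorem measurable_envTr (k : ℤ) : Measurable (envTr k) :=
  measurable_pi_lambda _ fun _ => measurable_pi_apply _

theorem envTr_envTr (j k : ℤ) (C : ℤ → Bool) : envTr j (envTr k C) = envTr (j + k) C := by
  funext x; simp [envTr, add_assoc]

theorem envTr_zero (C : ℤ → Bool) : envTr 0 C = C := by
  funext x; simp [envTr]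

theorem envShift_eq : envShift = envTr 1 := rfl

theorem measurable_skew : Measurable skew := by
  refine Measurable.prodMk ?_ ?_
  · exact measurable_pi_lambda _ fun n => (measurable_pi_apply _).comp measurable_fst
  · have h1 : Measurable fun q : ℤ × (ℤ → Bool) => envTr q.1 q.2 :=
      measurable_from_prod_countable_right fun k => measurable_envTr k
    have h2 : Measurable fun p : (ℕ → Fin 4) × (ℤ → Bool) => (dstep (p.2 0) (p.1 0)).1 := by
      have h3 : Measurable fun q : Bool × Fin 4 => (dstep q.1 q.2).1 := measurable_of_countable _
      have h4 : Measurable fun p : (ℕ → Fin 4) × (ℤ → Bool) => (p.2 0, p.1 0) := by fun_prop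
      exact h3.comp h4
    exact h1.comp (h2.prodMk measurable_snd)

/-- The reversible weight. -/
def envW (C : ℤ → Bool) : ENNReal := if C 0 = true then 2 else 1

theorem measurable_envW : Measurable envW :=
  Measurable.ite (measurableSet_eq_fun (measurable_pi_apply 0) measurable_const)
    measurable_const measurable_const

/-- The invariant law of the skew product. -/
def invLaw (μ : Measure (ℤ → Bool)) : Measure ((ℕ → Fin 4) × (ℤ → Bool)) :=
  coinLaw.prod (μ.withDensity envW)

instance (μ : Measure (ℤ → Bool)) [IsProbabilityMeasure μ] :
    IsFiniteMeasure (μ.withDensity envW) := by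
  refine isFiniteMeasure_withDensity ?_
  refine ne_of_lt (lt_of_le_of_lt (lintegral_mono (g := fun _ => 2) fun C => ?_) ?_)
  · simp only [envW]; split_ifs <;> norm_num
  · simp

instance (μ : Measure (ℤ → Bool)) [IsProbabilityMeasure μ] : IsFiniteMeasure (invLaw μ) := by
  unfold invLaw; infer_instance

theorem section_skew {S : Set ((ℕ → Fin 4) × (ℤ → Bool))} (hS : MeasurableSet S)
    (C : ℤ → Bool) :
    coinLaw ((fun U => (U, C)) ⁻¹' (skew ⁻¹' S)) = ∑ u : Fin 4, (4 : ENNReal)⁻¹ *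
      coinLaw ((fun U => (U, envTr (dstep (C 0) u).1 C)) ⁻¹' S) := by
  rw [coinLaw_apply (measurable_prodMk_right (measurable_skew hS))]
  rfl

theorem lintegral_envTr {μ : Measure (ℤ → Bool)} (hμ : MeasurePreserving envShift μ μ)
    {G : (ℤ → Bool) → ENNReal} (hG : Measurable G) :
    ∫⁻ C, G (envTr 1 C) ∂μ = ∫⁻ C, G C ∂μ ∧ ∫⁻ C, G (envTr (-1) C) ∂μ = ∫⁻ C, G C ∂μ := by
  constructor
  · exact hμ.lintegral_comp hG
  · have h : Measurable fun C => G (envTr (-1) C) := hG.comp (measurable_envTr (-1))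
    rw [← hμ.lintegral_comp h]
    simp [envShift_eq, envTr_envTr, envTr_zero]

theorem weight_sum (G : (ℤ → Bool) → ENNReal) (C : ℤ → Bool) :
    envW C * ∑ u : Fin 4, (4 : ENNReal)⁻¹ * G (envTr (dstep (C 0) u).1 C)
      = 2⁻¹ * G (envTr 1 C) + 2⁻¹ * G (envTr (-1) C) + (if C 0 = true then G C else 0) := by
  have h42 : (2 : ENNReal) * 4⁻¹ = 2⁻¹ := by
    rw [show (4 : ENNReal) = 2 * 2 by norm_num, ENNReal.mul_inv (by norm_num) (by norm_num),
      ← mul_assoc, ENNReal.mul_inv_cancel (by norm_num) (by norm_num), one_mul]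
  have h1 : (1 : ENNReal) = 2⁻¹ + 2⁻¹ := (ENNReal.inv_two_add_inv_two).symm
  rcases hC : C 0 with _ | _
  · simp only [envW, hC, dstep, Fin.sum_univ_four]
    simp
    rw [← h42]; ring
  · simp only [envW, hC, dstep, Fin.sum_univ_four]
    simp [envTr_zero]
    have : G C = (2⁻¹ + 2⁻¹) * G C := by rw [← h1, one_mul]
    conv_rhs => rw [this]
    rw [← h42]; ring

theorem measurePreserving_skew {μ : Measure (ℤ → Bool)} [IsProbabilityMeasure μ]
    (hμ : MeasurePreserving envShift μ μ) :
    MeasurePreserving skew (invLaw μ) (invLaw μ) := by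
  refine ⟨measurable_skew, Measure.ext fun S hS => ?_⟩
  rw [Measure.map_apply measurable_skew hS, invLaw, Measure.prod_apply_symm hS,
    Measure.prod_apply_symm (measurable_skew hS)]
  simp_rw [section_skew hS]
  set G : (ℤ → Bool) → ENNReal := fun C => coinLaw ((fun U => (U, C)) ⁻¹' S) with hG
  have hGm : Measurable G := measurable_measure_prodMk_right hS
  change ∫⁻ C, ∑ u : Fin 4, (4 : ENNReal)⁻¹ * G (envTr (dstep (C 0) u).1 C) ∂_ = ∫⁻ C, G C ∂_
  have hm : Measurable fun C : ℤ → Bool =>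
      ∑ u : Fin 4, (4 : ENNReal)⁻¹ * G (envTr (dstep (C 0) u).1 C) := by
    have : (fun C : ℤ → Bool => ∑ u : Fin 4, (4 : ENNReal)⁻¹ * G (envTr (dstep (C 0) u).1 C))
        = fun C => coinLaw ((fun U => (U, C)) ⁻¹' (skew ⁻¹' S)) := by
      funext C; rw [section_skew hS]
    rw [this]
    exact measurable_measure_prodMk_right (measurable_skew hS)
  have hC0 : MeasurableSet {C : ℤ → Bool | C 0 = true} :=
    measurableSet_eq_fun (measurable_pi_apply 0) measurable_const
  have hind : Measurable fun C : ℤ → Bool => if C 0 = true then G C else 0 :=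
    Measurable.ite hC0 hGm measurable_const
  rw [lintegral_withDensity_eq_lintegral_mul _ measurable_envW hm,
    lintegral_withDensity_eq_lintegral_mul _ measurable_envW hGm]
  simp only [Pi.mul_apply]
  simp_rw [weight_sum]
  have h1 : Measurable fun C => G (envTr 1 C) := hGm.comp (measurable_envTr 1)
  have h2 : Measurable fun C => G (envTr (-1) C) := hGm.comp (measurable_envTr (-1))
  have e : ∀ C : ℤ → Bool, envW C * G C = G C + if C 0 = true then G C else 0 := by
    intro C
    simp only [envW]; split_ifs
    · ring
    · simp
  simp_rw [e]
  rw [lintegral_add_right _ hind, lintegral_add_right _ hind,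
    lintegral_add_left (h1.const_mul _), lintegral_const_mul _ h1, lintegral_const_mul _ h2]
  rw [(lintegral_envTr hμ hGm).1, (lintegral_envTr hμ hGm).2, ← add_mul,
    ENNReal.inv_two_add_inv_two, one_mul]

theorem bounded_harmonic_const (a : ℤ → ℝ) (h0 : ∀ k, 0 ≤ a k) (h1 : ∀ k, a k ≤ 1)
    (hh : ∀ k, a k = (a (k + 1) + a (k - 1)) / 2) (k : ℤ) : a (k + 1) = a k := by
  have key : ∀ n : ℕ, a (k + n) = a k + n * (a (k + 1) - a k) ∧
      a (k + n + 1) = a k + (n + 1) * (a (k + 1) - a k) := by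
    intro n
    induction n with
    | zero => simp
    | succ n ih =>
      have := hh (k + n + 1)
      rw [show k + (n : ℤ) + 1 - 1 = k + n by ring, ih.1, ih.2] at this
      push_cast
      rw [← add_assoc, ih.2]
      constructor
      · ring
      · linarith
  by_contra hne
  have hd : a (k + 1) - a k ≠ 0 := sub_ne_zero.2 hne
  obtain ⟨n, hn⟩ := exists_nat_gt (2 / |a (k + 1) - a k|)
  have hpos : 0 < |a (k + 1) - a k| := abs_pos.2 hd
  rw [div_lt_iff₀ hpos] at hn
  have e1 : (n : ℝ) * (a (k + 1) - a k) = a (k + n) - a k := by rw [(key n).1]; ring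
  have e2 : (n : ℝ) * |a (k + 1) - a k| = |a (k + n) - a k| := by
    rw [← e1, abs_mul, abs_of_nonneg (Nat.cast_nonneg n : (0 : ℝ) ≤ n)]
  have e3 : |a (k + n) - a k| ≤ 1 := by
    rw [abs_le]
    have := h0 k; have := h1 k; have := h0 (k + n); have := h1 (k + n)
    constructor <;> linarith
  linarith

theorem section_invariant {S : Set ((ℕ → Fin 4) × (ℤ → Bool))} (hS : MeasurableSet S)
    (hinv : skew ⁻¹' S = S) (C : ℤ → Bool) (k : ℤ) :
    coinLaw ((fun U => (U, envTr k C)) ⁻¹' S) = coinLaw ((fun U => (U, C)) ⁻¹' S) := by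
  set a : ℤ → ℝ := fun k => (coinLaw ((fun U => (U, envTr k C)) ⁻¹' S)).toReal with ha
  have hh : ∀ k, a k = (a (k + 1) + a (k - 1)) / 2 := by
    intro k
    have h := section_skew hS (envTr k C)
    rw [hinv] at h
    have h' := congrArg ENNReal.toReal h
    rw [ENNReal.toReal_sum (fun u _ => ENNReal.mul_ne_top (by norm_num) (measure_ne_top _ _))] at h'
    simp only [ENNReal.toReal_mul, envTr_envTr] at h'
    have h4 : ((4 : ENNReal)⁻¹).toReal = 1 / 4 := by simp
    rw [h4, Fin.sum_univ_four] at h'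
    rcases hC : envTr k C 0 with _ | _
    · rw [hC] at h'
      simp [dstep] at h'
      simp only [ha]
      rw [h', add_comm 1 k, show -1 + k = k - 1 by ring]
      ring
    · rw [hC] at h'
      simp [dstep] at h'
      rw [add_comm 1 k, show -1 + k = k - 1 by ring] at h'
      simp only [ha]
      linarith
  have hstep := bounded_harmonic_const a (fun _ => ENNReal.toReal_nonneg)
    (fun k => by
      have := ENNReal.toReal_mono ENNReal.one_ne_top
        (prob_le_one (μ := coinLaw) (s := (fun U => (U, envTr k C)) ⁻¹' S))
      simpa using this) hh
  have hall : ∀ k, a k = a 0 := by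
    intro k
    induction k using Int.induction_on with
    | zero => rfl
    | succ i ih => rw [hstep, ih]
    | pred i ih =>
      rw [← ih, ← hstep (-(i : ℤ) - 1)]
      congr 1; ring
  have := hall k
  simp only [ha, envTr_zero] at this
  exact (ENNReal.toReal_eq_toReal_iff' (measure_ne_top _ _) (measure_ne_top _ _)).1 this

theorem section_inter {S : Set ((ℕ → Fin 4) × (ℤ → Bool))} (hS : MeasurableSet S)
    (hinv : skew ⁻¹' S = S) (n : ℕ) :
    ∀ (C : ℤ → Bool) (B : Set (ℕ → Fin 4)), MeasurableSet B →
      (∀ U V : ℕ → Fin 4, (∀ i < n, U i = V i) → U ∈ B → V ∈ B) →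
      coinLaw (((fun U => (U, C)) ⁻¹' S) ∩ B) =
        coinLaw ((fun U => (U, C)) ⁻¹' S) * coinLaw B := by
  induction n with
  | zero =>
    intro C B hB hdet
    rcases B.eq_empty_or_nonempty with rfl | ⟨U, hU⟩
    · simp
    · have : B = univ := eq_univ_of_forall fun V => hdet U V (by simp) hU
      simp [this]
  | succ n ih =>
    intro C B hB hdet
    have hSC : MeasurableSet ((fun U : ℕ → Fin 4 => (U, C)) ⁻¹' S) := measurable_prodMk_right hS
    rw [coinLaw_apply (hSC.inter hB), coinLaw_apply hB, Finset.mul_sum]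
    refine Finset.sum_congr rfl fun u _ => ?_
    have e : scons u ⁻¹' (((fun U => (U, C)) ⁻¹' S) ∩ B) =
        ((fun U => (U, envTr (dstep (C 0) u).1 C)) ⁻¹' S) ∩ (scons u ⁻¹' B) := by
      conv_lhs => rw [← hinv]
      rfl
    rw [e, ih _ _ (measurable_scons' u hB), section_invariant hS hinv]
    · ring
    · intro U V hUV hU
      refine hdet (scons u U) (scons u V) ?_ hU
      intro i hi
      cases i with
      | zero => rfl
      | succ i => exact hUV i (by omega)

theorem section_zero_one {S : Set ((ℕ → Fin 4) × (ℤ → Bool))} (hS : MeasurableSet S)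
    (hinv : skew ⁻¹' S = S) (C : ℤ → Bool) :
    coinLaw ((fun U => (U, C)) ⁻¹' S) = 0 ∨ coinLaw ((fun U => (U, C)) ⁻¹' S)ᶜ = 0 := by
  by_cases h0 : coinLaw ((fun U => (U, C)) ⁻¹' S) = 0
  · exact Or.inl h0
  right
  have hSC : MeasurableSet ((fun U : ℕ → Fin 4 => (U, C)) ⁻¹' S) := measurable_prodMk_right hS
  set g := coinLaw ((fun U => (U, C)) ⁻¹' S) with hg
  have hgt : g ≠ ⊤ := measure_ne_top _ _
  have key : g⁻¹ • coinLaw.restrict ((fun U => (U, C)) ⁻¹' S) = coinLaw := by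
    refine Measure.eq_infinitePi _ fun s t ht => ?_
    have hmB : MeasurableSet ((s : Set ℕ).pi t) :=
      MeasurableSet.pi (Finset.countable_toSet _) fun i _ => ht i
    obtain ⟨N, hN⟩ := s.exists_nat_subset_range
    have := section_inter hS hinv N C ((s : Set ℕ).pi t) hmB (by
      intro U V hUV hU i hi
      rw [← hUV i (Finset.mem_range.1 (hN hi))]
      exact hU i hi)
    rw [Measure.smul_apply, Measure.restrict_apply hmB, inter_comm, this, smul_eq_mul,
      ← mul_assoc, ENNReal.inv_mul_cancel h0 hgt, one_mul]
    exact Measure.infinitePi_pi _ fun i _ => ht i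
  rw [← key, Measure.smul_apply, Measure.restrict_apply hSC.compl]
  simp

theorem ergodic_skew {μ : Measure (ℤ → Bool)} [IsProbabilityMeasure μ]
    (hμ : Ergodic envShift μ) : Ergodic skew (invLaw μ) := by
  refine ⟨measurePreserving_skew hμ.toMeasurePreserving, ⟨fun S hS hinv => ?_⟩⟩
  set D : Set (ℤ → Bool) := {C | coinLaw ((fun U => (U, C)) ⁻¹' S) = 0} with hD
  have hDm : MeasurableSet D :=
    (measurable_measure_prodMk_right hS) (measurableSet_singleton (0 : ENNReal))
  have hDi : envShift ⁻¹' D = D := by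
    ext C
    simp only [hD, mem_preimage, mem_ofPred_eq, envShift_eq]
    rw [section_invariant hS hinv]
  have hac : μ.withDensity envW ≪ μ := withDensity_absolutelyContinuous _ _
  rw [eventuallyConst_set']
  rcases eventuallyConst_set'.1 (hμ.toPreErgodic.aeconst_set hDm hDi) with h | h
  · right
    rw [ae_eq_univ, invLaw, Measure.prod_apply_symm hS.compl]
    rw [lintegral_eq_zero_iff (measurable_measure_prodMk_right hS.compl)]
    refine hac.ae_le ?_
    filter_upwards [h] with C hC
    have hC' : C ∉ D := fun hh => by
      have e : (C ∈ D) = (C ∈ (∅ : Set (ℤ → Bool))) := hC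
      rw [e] at hh; exact hh
    exact (section_zero_one hS hinv C).resolve_left hC'
  · left
    rw [ae_eq_empty, invLaw, Measure.prod_apply_symm hS]
    rw [lintegral_eq_zero_iff (measurable_measure_prodMk_right hS)]
    refine hac.ae_le ?_
    filter_upwards [h] with C hC
    have e : (C ∈ D) = (C ∈ (univ : Set (ℤ → Bool))) := hC
    have hC' : C ∈ D := by rw [e]; trivial
    exact hC'

/-- The integrand: indicator of a vertical step. -/
def vertInd (p : (ℕ → Fin 4) × (ℤ → Bool)) : ℝ :=
  if (dstep (p.2 0) (p.1 0)).2 ≠ 0 then 1 else 0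

/-- The walk started at `z` in the environment `C` driven by the letters `U`. -/
def cwalk : ℕ → (ℤ × ℤ) → (ℕ → Fin 4) × (ℤ → Bool) → ℤ × ℤ
  | 0, z, _ => z
  | n + 1, z, p => cwalk n (z + dstep (p.2 z.1) (p.1 0)) (fun n => p.1 (n + 1), p.2)

theorem dstep_fst_ne_iff (b : Bool) (u : Fin 4) : (dstep b u).1 ≠ 0 ↔ (dstep b u).2 = 0 := by
  revert b u; decide

theorem measurable_vertInd : Measurable vertInd := by
  have h3 : Measurable fun q : Bool × Fin 4 => if (dstep q.1 q.2).2 ≠ 0 then (1 : ℝ) else 0 :=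
    measurable_of_countable _
  have h4 : Measurable fun p : (ℕ → Fin 4) × (ℤ → Bool) => (p.2 0, p.1 0) := by fun_prop
  exact h3.comp h4

theorem cwalk_ny (n : ℕ) (z : ℤ × ℤ) (p : (ℕ → Fin 4) × (ℤ → Bool)) :
    (nySteps (fun n => cwalk n z) n p : ℝ) = birkhoffSum skew vertInd n (p.1, envTr z.1 p.2) := by
  induction n generalizing z p with
  | zero => simp [nySteps]
  | succ n ih =>
    rw [birkhoffSum_succ']
    have hsk : skew (p.1, envTr z.1 p.2) = ((fun n => p.1 (n + 1)),
        envTr (z + dstep (p.2 z.1) (p.1 0)).1 p.2) := by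
      simp only [skew, envTr_envTr]
      simp [envTr, add_comm]
    rw [hsk]
    rw [← ih (z + dstep (p.2 z.1) (p.1 0)) ((fun n => p.1 (n + 1)), p.2)]
    simp only [nySteps, Finset.card_filter]
    rw [Finset.sum_range_succ']
    push_cast
    rw [add_comm]
    congr 1
    simp [cwalk, vertInd, envTr]

theorem cwalk_step (n : ℕ) (z : ℤ × ℤ) (p : (ℕ → Fin 4) × (ℤ → Bool)) :
    (cwalk (n + 1) z p).1 ≠ (cwalk n z p).1 ↔ ¬ (cwalk (n + 1) z p).2 ≠ (cwalk n z p).2 := by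
  induction n generalizing z p with
  | zero =>
    have := dstep_fst_ne_iff (p.2 z.1) (p.1 0)
    simpa [cwalk] using this
  | succ n ih =>
    exact ih (z + dstep (p.2 z.1) (p.1 0)) ((fun n => p.1 (n + 1)), p.2)

theorem cwalk_nx (n : ℕ) (z : ℤ × ℤ) (p : (ℕ → Fin 4) × (ℤ → Bool)) :
    (nxSteps (fun n => cwalk n z) n p : ℝ) = n - nySteps (fun n => cwalk n z) n p := by
  have h := Finset.card_filter_add_card_filter_not (s := Finset.range n)
    (fun m => (cwalk (m + 1) z p).2 ≠ (cwalk m z p).2)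
  rw [Finset.card_range] at h
  have e : nxSteps (fun n => cwalk n z) n p = ((Finset.range n).filter fun m =>
      ¬ (cwalk (m + 1) z p).2 ≠ (cwalk m z p).2).card := by
    unfold nxSteps
    congr 1
    ext m
    simp only [Finset.mem_filter, cwalk_step]
  rw [e, nySteps, eq_sub_iff_add_eq, add_comm]
  exact_mod_cast h

theorem measurable_cwalk (n : ℕ) : Measurable fun q : (ℤ × ℤ) × ((ℕ → Fin 4) × (ℤ → Bool)) =>
    cwalk n q.1 q.2 := by
  induction n with
  | zero => exact measurable_fst
  | succ n ih =>
    refine measurable_from_prod_countable_right fun z => ?_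
    have h3 : Measurable fun q : Bool × Fin 4 => z + dstep q.1 q.2 := measurable_of_countable _
    have h4 : Measurable fun p : (ℕ → Fin 4) × (ℤ → Bool) => (p.2 z.1, p.1 0) := by fun_prop
    have h5 : Measurable fun p : (ℕ → Fin 4) × (ℤ → Bool) =>
        ((fun n => p.1 (n + 1) : ℕ → Fin 4), p.2) := by fun_prop
    exact ih.comp ((h3.comp h4).prodMk h5)

theorem step_prob (b : Bool) (z w : ℤ × ℤ) :
    ∑ u : Fin 4, (4 : ENNReal)⁻¹ * (if w = z + dstep b u then 1 else 0) =
      ENNReal.ofReal (rwreStep b z w) := by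
  have h4 : ENNReal.ofReal (1 / 4) = 4⁻¹ := by
    rw [one_div, ENNReal.ofReal_inv_of_pos (by norm_num)]; norm_num
  have h2 : ENNReal.ofReal (1 / 2) = 4⁻¹ + 4⁻¹ := by
    rw [← h4, ← ENNReal.ofReal_add (by norm_num) (by norm_num)]; norm_num
  obtain ⟨z1, z2⟩ := z
  obtain ⟨w1, w2⟩ := w
  cases b
  · have d0 : dstep false 0 = (1, 0) := rfl
    have d1 : dstep false 1 = (-1, 0) := rfl
    have d2 : dstep false 2 = (1, 0) := rfl
    have d3 : dstep false 3 = (-1, 0) := rfl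
    simp only [rwreStep, Fin.sum_univ_four, d0, d1, d2, d3, Prod.mk_add_mk, Prod.mk.injEq]
    by_cases ha : w1 = z1 + 1 ∧ w2 = z2
    · obtain ⟨rfl, rfl⟩ := ha
      have : ¬ (z1 + 1 = z1 + -1) := by omega
      simp [this]; rw [← h2]; simp
    · by_cases hb : w1 = z1 - 1 ∧ w2 = z2
      · obtain ⟨rfl, rfl⟩ := hb
        have h5 : ¬ (z1 - 1 = z1 + 1) := by omega
        have h6 : (z1 - 1 = z1 + -1) := by omega
        simp [h5, ← h6]; rw [← h2]; simp
      · have hb' : ¬ (w1 = z1 + -1 ∧ w2 = z2) := by omega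
        simp [ha, hb, hb']
  · have d0 : dstep true 0 = (1, 0) := rfl
    have d1 : dstep true 1 = (-1, 0) := rfl
    have d2 : dstep true 2 = (0, 1) := rfl
    have d3 : dstep true 3 = (0, -1) := rfl
    simp only [rwreStep, Fin.sum_univ_four, d0, d1, d2, d3, Prod.mk_add_mk, Prod.mk.injEq]
    have hx : ∀ P Q R S : Prop, ∀ [Decidable P] [Decidable Q] [Decidable R] [Decidable S],
        (P → ¬ Q ∧ ¬ R ∧ ¬ S) → (Q → ¬ R ∧ ¬ S) → (R → ¬ S) →
        (4 : ENNReal)⁻¹ * (if P then 1 else 0) + 4⁻¹ * (if Q then 1 else 0)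
          + 4⁻¹ * (if R then 1 else 0) + 4⁻¹ * (if S then 1 else 0)
          = if P ∨ Q ∨ R ∨ S then 4⁻¹ else 0 := by
      intro P Q R S _ _ _ _ h1 h2 h3
      by_cases hP : P
      · simp [hP, h1 hP]
      · by_cases hQ : Q
        · simp [hP, hQ, h2 hQ]
        · by_cases hR : R
          · simp [hP, hQ, hR, h3 hR]
          · by_cases hS : S <;> simp [hP, hQ, hR, hS]
    have := hx (w1 = z1 + 1 ∧ w2 = z2) (w1 = z1 - 1 ∧ w2 = z2) (w1 = z1 ∧ w2 = z2 + 1)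
      (w1 = z1 ∧ w2 = z2 - 1) (by omega) (by omega) (by omega)
    simp [← sub_eq_add_neg] at this ⊢
    rw [this]
    split_ifs
    · rw [← h4]; simp
    · simp

/-- Quenched probability of a finite path. -/
def pathProb (C : ℤ → Bool) (f : ℕ → ℤ × ℤ) (n : ℕ) : ENNReal :=
  ∏ i ∈ Finset.range n, ENNReal.ofReal (rwreStep (C (f i).1) (f i) (f (i + 1)))

theorem measurable_pathProb (f : ℕ → ℤ × ℤ) (n : ℕ) : Measurable fun C => pathProb C f n := by
  refine Finset.measurable_fun_prod _ fun i _ => ?_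
  have h3 : Measurable fun b : Bool => ENNReal.ofReal (rwreStep b (f i) (f (i + 1))) :=
    measurable_of_countable _
  exact h3.comp (measurable_pi_apply (f i).1)

theorem coin_path (n : ℕ) (C : ℤ → Bool) (z : ℤ × ℤ) (f : ℕ → ℤ × ℤ) :
    coinLaw {U | ∀ i ≤ n, cwalk i z (U, C) = f i} =
      (if f 0 = z then 1 else 0) * pathProb C f n := by
  have hmeas : ∀ (n : ℕ) (z : ℤ × ℤ) (f : ℕ → ℤ × ℤ),
      MeasurableSet {U | ∀ i ≤ n, cwalk i z (U, C) = f i} := by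
    intro n z f
    have : {U | ∀ i ≤ n, cwalk i z (U, C) = f i} =
        ⋂ i, ⋂ (_ : i ≤ n), {U | cwalk i z (U, C) = f i} := by ext; simp
    rw [this]
    refine MeasurableSet.iInter fun i => MeasurableSet.iInter fun _ => ?_
    have h : Measurable fun U : ℕ → Fin 4 => cwalk i z (U, C) :=
      (measurable_cwalk i).comp (measurable_const.prodMk (measurable_id.prodMk measurable_const))
    exact h (measurableSet_singleton (f i))
  induction n generalizing z f with
  | zero =>
    by_cases h : f 0 = z
    · simp [cwalk, pathProb, h]
    · simp [cwalk, pathProb, h, Ne.symm h]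
  | succ n ih =>
    rw [coinLaw_apply (hmeas _ _ _)]
    by_cases h : f 0 = z
    · have e : ∀ u, scons u ⁻¹' {U | ∀ i ≤ n + 1, cwalk i z (U, C) = f i} =
          {U | ∀ i ≤ n, cwalk i (z + dstep (C z.1) u) (U, C) = f (i + 1)} := by
        intro u
        ext U
        simp only [mem_preimage, mem_ofPred_eq]
        constructor
        · intro hh i hi
          exact hh (i + 1) (by omega)
        · intro hh i hi
          cases i with
          | zero => exact h.symm
          | succ i => exact hh i (by omega)
      simp_rw [e]
      have ih' := fun u => ih (z + dstep (C z.1) u) (fun i => f (i + 1))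
      simp only [ih', ← mul_assoc]
      rw [← Finset.sum_mul]
      rw [zero_add, step_prob, if_pos h, one_mul, pathProb, pathProb, Finset.prod_range_succ', h,
        mul_comm]
    · rw [if_neg h, zero_mul]
      refine Finset.sum_eq_zero fun u _ => ?_
      have e : scons u ⁻¹' {U | ∀ i ≤ n + 1, cwalk i z (U, C) = f i} = ∅ := by
        ext U
        simp only [mem_preimage, mem_ofPred_eq, mem_empty_iff_false, iff_false]
        intro hh
        exact h (hh 0 (by omega)).symm
      rw [e]; simp

theorem rwre_path {μ : Measure (ℤ → Bool)} {Ω : Type*} [MeasurableSpace Ω] {P : Measure Ω}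
    {E : Ω → ℤ → Bool} {Z : ℕ → Ω → ℤ × ℤ} (hZ : IsRWRE P μ E Z) (n : ℕ) (f : ℕ → ℤ × ℤ)
    (A : Set (ℤ → Bool)) (hA : MeasurableSet A) :
    P {ω | E ω ∈ A ∧ ∀ i ≤ n, Z i ω = f i} =
      ∫⁻ C in A, (if f 0 = 0 then 1 else 0) * pathProb C f n ∂μ := by
  obtain ⟨hE, hZm, hmap, h0, hstep⟩ := hZ
  induction n generalizing A with
  | zero =>
    by_cases h : f 0 = 0
    · simp only [pathProb, h, if_true, Finset.range_zero, Finset.prod_empty, mul_one,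
        lintegral_one, Measure.restrict_apply_univ]
      rw [← hmap, Measure.map_apply hE hA]
      refine measure_congr ?_
      filter_upwards [h0] with ω hω
      refine propext ?_
      change (E ω ∈ A ∧ ∀ i ≤ 0, Z i ω = f i) ↔ E ω ∈ A
      simp [hω, h]
    · simp only [h, if_false, zero_mul, lintegral_zero]
      refine measure_mono_null ?_ (ae_iff.1 h0)
      rintro ω ⟨_, hω⟩ hω'
      exact h ((hω 0 le_rfl).symm.trans hω')
  | succ n ih =>
    have hb : ∀ b : Bool, ∀ A : Set (ℤ → Bool), MeasurableSet A → (∀ C ∈ A, C (f n).1 = b) →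
        P {ω | E ω ∈ A ∧ ∀ i ≤ n + 1, Z i ω = f i} =
          ∫⁻ C in A, (if f 0 = 0 then 1 else 0) * pathProb C f (n + 1) ∂μ := by
      intro b A hA hAb
      have e : {ω | E ω ∈ A ∧ ∀ i ≤ n + 1, Z i ω = f i} =
          {ω | E ω ∈ A ∧ (∀ i ≤ n, Z i ω = f i) ∧ Z (n + 1) ω = f (n + 1)} := by
        ext ω
        simp only [mem_ofPred_eq]
        refine and_congr_right fun _ => ?_
        constructor
        · intro h
          exact ⟨fun i hi => h i (by omega), h _ le_rfl⟩
        · rintro ⟨h1, h2⟩ i hi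
          rcases Nat.lt_or_ge n i with h | h
          · have : i = n + 1 := by omega
            rw [this]; exact h2
          · exact h1 i h
      rw [e, hstep n f _ b A hA hAb, ih A hA, ← lintegral_const_mul]
      · refine setLIntegral_congr_fun hA fun C hC => ?_
        simp only [pathProb, Finset.prod_range_succ, hAb C hC]
        ring
      · exact (measurable_pathProb f n).const_mul _
    have hD : MeasurableSet {C : ℤ → Bool | C (f n).1 = true} :=
      measurableSet_eq_fun (measurable_pi_apply (f n).1) measurable_const
    rw [← lintegral_inter_add_sdiff _ A hD,
      ← hb true _ (hA.inter hD) (fun C hC => hC.2),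
      ← hb false _ (hA.diff hD) (fun C hC => by simpa using hC.2)]
    have hED : MeasurableSet {ω | E ω (f n).1 = true} := hE hD
    rw [← measure_inter_add_sdiff _ hED]
    congr 2
    · ext ω; simp only [mem_inter_iff, mem_ofPred_eq]; tauto
    · ext ω; simp only [Set.mem_sdiff, mem_ofPred_eq]; tauto

theorem pathLaw_ext {ν₁ ν₂ : Measure ((ℤ → Bool) × (ℕ → ℤ × ℤ))} [IsFiniteMeasure ν₁]
    [IsFiniteMeasure ν₂]
    (h : ∀ (n : ℕ) (f : ℕ → ℤ × ℤ) (A : Set (ℤ → Bool)), MeasurableSet A →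
      ν₁ {q | q.1 ∈ A ∧ ∀ i ≤ n, q.2 i = f i} = ν₂ {q | q.1 ∈ A ∧ ∀ i ≤ n, q.2 i = f i}) :
    ν₁ = ν₂ := by
  refine Measure.ext_prod fun {A B} hA hB => ?_
  have hR : ∀ ν : Measure ((ℤ → Bool) × (ℕ → ℤ × ℤ)), ∀ B, MeasurableSet B →
      ν (A ×ˢ B) = ((ν.restrict (Prod.fst ⁻¹' A)).map Prod.snd) B := by
    intro ν B hB
    rw [Measure.map_apply measurable_snd hB, Measure.restrict_apply (measurable_snd hB)]
    congr 1
    ext q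
    simp only [mem_prod, mem_inter_iff, mem_preimage]
    tauto
  rw [hR ν₁ B hB, hR ν₂ B hB]
  congr 1
  set κ₁ := (ν₁.restrict (Prod.fst ⁻¹' A)).map Prod.snd with hκ₁
  set κ₂ := (ν₂.restrict (Prod.fst ⁻¹' A)).map Prod.snd with hκ₂
  have hIic : ∀ n : ℕ, κ₁.map (Finset.Iic n).restrict = κ₂.map (Finset.Iic n).restrict := by
    intro n
    refine Measure.ext_of_singleton fun a => ?_
    have hm : Measurable ((Finset.Iic n).restrict : (ℕ → ℤ × ℤ) → _) :=
      Finset.measurable_restrict _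
    rw [Measure.map_apply hm (measurableSet_singleton _),
      Measure.map_apply hm (measurableSet_singleton _), hκ₁, hκ₂,
      ← hR ν₁ _ (hm (measurableSet_singleton _)), ← hR ν₂ _ (hm (measurableSet_singleton _))]
    set f : ℕ → ℤ × ℤ := fun i => if hi : i ∈ Finset.Iic n then a ⟨i, hi⟩ else 0 with hf
    have e : A ×ˢ (((Finset.Iic n).restrict : (ℕ → ℤ × ℤ) → (Finset.Iic n → ℤ × ℤ)) ⁻¹' {a}) =
        {q : (ℤ → Bool) × (ℕ → ℤ × ℤ) | q.1 ∈ A ∧ ∀ i ≤ n, q.2 i = f i} := by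
      ext q
      simp only [mem_prod, mem_preimage, mem_singleton_iff, mem_ofPred_eq]
      refine and_congr_right fun _ => ?_
      constructor
      · intro hq i hi
        have hi' : i ∈ Finset.Iic n := Finset.mem_Iic.2 hi
        simp only [hf, hi', dif_pos, ← hq]
        rfl
      · intro hq
        funext ⟨i, hi⟩
        have := hq i (Finset.mem_Iic.1 hi)
        simp only [hf, hi, dif_pos] at this
        exact this
    rw [e, h n f A hA]
  have hall : ∀ I : Finset ℕ, κ₁.map I.restrict = κ₂.map I.restrict := by
    intro I
    obtain ⟨N, hN⟩ := I.exists_nat_subset_range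
    have hN' : I ⊆ Finset.Iic N := fun i hi =>
      Finset.mem_Iic.2 (Finset.mem_range.1 (hN hi)).le
    have hc := hIic N
    rw [← Finset.restrict₂_comp_restrict hN', ← Measure.map_map (by fun_prop) (by fun_prop), hc,
      Measure.map_map (by fun_prop) (by fun_prop)]
  exact IsProjectiveLimit.unique (P := fun I => κ₂.map I.restrict) hall fun I => rfl

theorem measurable_pathMap : Measurable fun p : (ℕ → Fin 4) × (ℤ → Bool) =>
    ((p.2, fun n => cwalk n 0 p) : (ℤ → Bool) × (ℕ → ℤ × ℤ)) := by
  refine measurable_snd.prodMk (measurable_pi_lambda _ fun n => ?_)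
  exact (measurable_cwalk n).comp (measurable_const.prodMk measurable_id)

theorem measurableSet_cyl (n : ℕ) (f : ℕ → ℤ × ℤ) (A : Set (ℤ → Bool)) (hA : MeasurableSet A) :
    MeasurableSet {q : (ℤ → Bool) × (ℕ → ℤ × ℤ) | q.1 ∈ A ∧ ∀ i ≤ n, q.2 i = f i} := by
  have : {q : (ℤ → Bool) × (ℕ → ℤ × ℤ) | q.1 ∈ A ∧ ∀ i ≤ n, q.2 i = f i} =
      (Prod.fst ⁻¹' A) ∩ ⋂ i, ⋂ (_ : i ≤ n),
        {q : (ℤ → Bool) × (ℕ → ℤ × ℤ) | q.2 i = f i} := by ext; simp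
  rw [this]
  refine (measurable_fst hA).inter
    (MeasurableSet.iInter fun i => MeasurableSet.iInter fun _ => ?_)
  exact measurableSet_eq_fun ((measurable_pi_apply i).comp measurable_snd) measurable_const

theorem law_eq {μ : Measure (ℤ → Bool)} [IsProbabilityMeasure μ] {Ω : Type*} [MeasurableSpace Ω]
    {P : Measure Ω} [IsProbabilityMeasure P]
    {E : Ω → ℤ → Bool} {Z : ℕ → Ω → ℤ × ℤ} (hZ : IsRWRE P μ E Z) :
    P.map (fun ω => ((E ω, fun n => Z n ω) : (ℤ → Bool) × (ℕ → ℤ × ℤ))) =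
      (coinLaw.prod μ).map (fun p => (p.2, fun n => cwalk n 0 p)) := by
  have hm1 : Measurable fun ω => ((E ω, fun n => Z n ω) : (ℤ → Bool) × (ℕ → ℤ × ℤ)) :=
    hZ.1.prodMk (measurable_pi_lambda _ hZ.2.1)
  have hm2 := measurable_pathMap
  refine pathLaw_ext fun n f A hA => ?_
  have hc := measurableSet_cyl n f A hA
  rw [Measure.map_apply hm1 hc, Measure.map_apply hm2 hc, Measure.prod_apply_symm (hm2 hc)]
  refine (rwre_path hZ n f A hA).trans ?_
  rw [← lintegral_indicator hA]
  refine lintegral_congr fun C => ?_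
  by_cases hC : C ∈ A
  · rw [indicator_of_mem hC, ← coin_path]
    congr 1
    ext U
    simp [hC]
  · rw [indicator_of_notMem hC]
    symm
    convert measure_empty (μ := coinLaw)
    ext U
    simp [hC]

theorem invLaw_univ {μ : Measure (ℤ → Bool)} [IsProbabilityMeasure μ] :
    invLaw μ univ = 1 + μ {C | C 0 = true} := by
  have hD : MeasurableSet {C : ℤ → Bool | C 0 = true} :=
    measurableSet_eq_fun (measurable_pi_apply 0) measurable_const
  rw [invLaw, ← univ_prod_univ, Measure.prod_prod, measure_univ, one_mul,
    withDensity_apply _ MeasurableSet.univ, Measure.restrict_univ]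
  have e : ∀ C, envW C = 1 + {C : ℤ → Bool | C 0 = true}.indicator 1 C := by
    intro C
    by_cases h : C 0 = true
    · simp [envW, h]; norm_num
    · simp [envW, h]
  simp_rw [e]
  rw [lintegral_add_left measurable_const, lintegral_indicator_one hD]
  simp

theorem coin_vert (C : ℤ → Bool) : coinLaw {U | (dstep (C 0) (U 0)).2 ≠ 0} =
    if C 0 = true then 2⁻¹ else 0 := by
  have hm : MeasurableSet {U : ℕ → Fin 4 | (dstep (C 0) (U 0)).2 ≠ 0} := by
    have h1 : MeasurableSet {u : Fin 4 | (dstep (C 0) u).2 ≠ 0} := MeasurableSet.of_discrete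
    exact (measurable_pi_apply (X := fun _ : ℕ => Fin 4) 0) h1
  rw [coinLaw_apply hm, Fin.sum_univ_four]
  have e : ∀ u, scons u ⁻¹' {U : ℕ → Fin 4 | (dstep (C 0) (U 0)).2 ≠ 0} =
      {_U | (dstep (C 0) u).2 ≠ 0} := fun u => rfl
  simp only [e]
  have h42 : (4 : ENNReal)⁻¹ + 4⁻¹ = 2⁻¹ := by
    rw [← two_mul, show (4 : ENNReal) = 2 * 2 by norm_num,
      ENNReal.mul_inv (by norm_num) (by norm_num),
      ← mul_assoc, ENNReal.mul_inv_cancel (by norm_num) (by norm_num), one_mul]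
  rcases hC : C 0 with _ | _
  · simp [dstep]
  · simp [dstep, h42]

theorem integral_vertInd {μ : Measure (ℤ → Bool)} [IsProbabilityMeasure μ] :
    ∫ p, vertInd p ∂(invLaw μ) = (μ {C | C 0 = true}).toReal := by
  have hD : MeasurableSet {C : ℤ → Bool | C 0 = true} :=
    measurableSet_eq_fun (measurable_pi_apply 0) measurable_const
  have hV : MeasurableSet {p : (ℕ → Fin 4) × (ℤ → Bool) | (dstep (p.2 0) (p.1 0)).2 ≠ 0} := by
    have h1 : MeasurableSet {b : Bool × Fin 4 | (dstep b.1 b.2).2 ≠ 0} := MeasurableSet.of_discrete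
    have h4 : Measurable fun p : (ℕ → Fin 4) × (ℤ → Bool) => (p.2 0, p.1 0) := by fun_prop
    exact h4 h1
  have e : vertInd = {p : (ℕ → Fin 4) × (ℤ → Bool) | (dstep (p.2 0) (p.1 0)).2 ≠ 0}.indicator 1 := by
    funext p
    simp only [vertInd, indicator, mem_ofPred_eq, Pi.one_apply]
  rw [e, integral_indicator_one hV, Measure.real]
  congr 1
  rw [invLaw, Measure.prod_apply_symm hV]
  have e2 : ∀ C : ℤ → Bool, coinLaw ((fun U => (U, C)) ⁻¹'
      {p : (ℕ → Fin 4) × (ℤ → Bool) | (dstep (p.2 0) (p.1 0)).2 ≠ 0}) =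
      if C 0 = true then 2⁻¹ else 0 := fun C => coin_vert C
  simp_rw [e2]
  have hm : Measurable fun C : ℤ → Bool => if C 0 = true then (2 : ENNReal)⁻¹ else 0 :=
    Measurable.ite hD measurable_const measurable_const
  rw [lintegral_withDensity_eq_lintegral_mul _ measurable_envW hm, ← lintegral_indicator_one hD]
  refine lintegral_congr fun C => ?_
  by_cases h : C 0 = true
  · simp [envW, h, ENNReal.mul_inv_cancel]
  · simp [envW, h]

theorem cwalk_limits {μ : Measure (ℤ → Bool)} [IsProbabilityMeasure μ]
    (hergodic : Ergodic envShift μ) (q : ℝ) (hq : q = (μ {C | C 0 = true}).toReal) :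
    ∀ᵐ p ∂(coinLaw.prod μ),
      Tendsto (fun n : ℕ => (nxSteps (fun n => cwalk n 0) n p : ℝ) / n) atTop
        (nhds (1 / (1 + q))) ∧
      Tendsto (fun n : ℕ => (nySteps (fun n => cwalk n 0) n p : ℝ) / n) atTop
        (nhds (q / (1 + q))) := by
  have hq0 : 0 ≤ q := hq ▸ ENNReal.toReal_nonneg
  have hac : coinLaw.prod μ ≪ invLaw μ := by
    refine Measure.AbsolutelyContinuous.rfl.prod ?_
    refine withDensity_absolutelyContinuous' measurable_envW.aemeasurable (ae_of_all _ fun C => ?_)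
    simp only [envW]; split_ifs <;> norm_num
  have hreal : (invLaw μ).real univ = 1 + q := by
    rw [Measure.real, invLaw_univ, ENNReal.toReal_add (by simp) (measure_ne_top _ _), hq]
    simp
  have hi : Integrable vertInd (invLaw μ) := by
    refine Integrable.of_bound measurable_vertInd.aestronglyMeasurable 1 (ae_of_all _ fun p => ?_)
    simp only [vertInd]; split_ifs <;> simp
  have hb := ae_tendsto_birkhoff (ergodic_skew hergodic) measurable_vertInd hi (q / (1 + q))
    (by rw [invLaw_univ]; simp)
    (by rw [integral_vertInd, hreal, ← hq]; field_simp)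
  filter_upwards [hac.ae_le hb] with p hp
  have hy : Tendsto (fun n : ℕ => (nySteps (fun n => cwalk n 0) n p : ℝ) / n) atTop
        (nhds (q / (1 + q))) := by
    refine hp.congr fun n => ?_
    rw [cwalk_ny]
    simp [envTr_zero]
  refine ⟨?_, hy⟩
  have h1 : (1 : ℝ) / (1 + q) = 1 - q / (1 + q) := by field_simp; ring
  rw [h1]
  refine (tendsto_const_nhds.sub hy).congr' ?_
  filter_upwards [eventually_gt_atTop 0] with n hn
  have : (n : ℝ) ≠ 0 := by exact_mod_cast hn.ne'
  rw [cwalk_nx]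
  field_simp

theorem measurable_pathCount (g : ℤ × ℤ → ℤ) (n : ℕ) :
    Measurable fun x : (ℤ → Bool) × (ℕ → ℤ × ℤ) =>
      (((Finset.range n).filter fun m => g (x.2 (m + 1)) ≠ g (x.2 m)).card : ℝ) / n := by
  refine Measurable.div_const ?_ _
  simp only [Finset.card_filter]
  push_cast
  refine Finset.measurable_fun_sum _ fun m _ => ?_
  have hg : Measurable g := measurable_of_countable _
  refine Measurable.ite ?_ measurable_const measurable_const
  exact (measurableSet_eq_fun (hg.comp ((measurable_pi_apply (m + 1)).comp measurable_snd))
    (hg.comp ((measurable_pi_apply m).comp measurable_snd))).compl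

/-- **Ansatz 1** (den Hollander (1994)).  If `μ` is a stationary ergodic probability law on
`{0,1}^ℤ` with `q = μ(C(0) = 1) ∈ (0,1]`, then for the random walk in random environment with
annealed law `P`, almost surely the proportions of horizontal and vertical steps satisfy
`n_x(n)/n → 1/(1+q)` and `n_y(n)/n → q/(1+q)`. -/
theorem ansatz1_step_proportions_RWRE
    (μ : Measure (ℤ → Bool)) [IsProbabilityMeasure μ] (hergodic : Ergodic envShift μ)
    (q : ℝ) (hq : q = (μ {C | C 0 = true}).toReal) (hq0 : 0 < q) (hq1 : q ≤ 1)
    {Ω : Type*} [MeasurableSpace Ω] (P : Measure Ω) [IsProbabilityMeasure P]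
    (E : Ω → ℤ → Bool) (Z : ℕ → Ω → ℤ × ℤ) (hZ : IsRWRE P μ E Z) :
    ∀ᵐ ω ∂P,
      Tendsto (fun n : ℕ => (nxSteps Z n ω : ℝ) / n) atTop (nhds (1 / (1 + q))) ∧
      Tendsto (fun n : ℕ => (nySteps Z n ω : ℝ) / n) atTop (nhds (q / (1 + q))) := by
  have hm1 : Measurable fun ω => ((E ω, fun n => Z n ω) : (ℤ → Bool) × (ℕ → ℤ × ℤ)) :=
    hZ.1.prodMk (measurable_pi_lambda _ hZ.2.1)
  have hcan := cwalk_limits hergodic q hq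
  set G : Set ((ℤ → Bool) × (ℕ → ℤ × ℤ)) := {x |
    Tendsto (fun n : ℕ => (((Finset.range n).filter fun m =>
      Prod.fst (x.2 (m + 1)) ≠ Prod.fst (x.2 m)).card : ℝ) / n) atTop (nhds (1 / (1 + q)))} ∩ {x |
    Tendsto (fun n : ℕ => (((Finset.range n).filter fun m =>
      Prod.snd (x.2 (m + 1)) ≠ Prod.snd (x.2 m)).card : ℝ) / n) atTop (nhds (q / (1 + q)))} with hG
  have hGm : MeasurableSet G :=
    (measurableSet_tendsto _ (measurable_pathCount Prod.fst)).inter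
      (measurableSet_tendsto _ (measurable_pathCount Prod.snd))
  have h2 : ∀ᵐ x ∂((coinLaw.prod μ).map
      (fun p => ((p.2, fun n => cwalk n 0 p) : (ℤ → Bool) × (ℕ → ℤ × ℤ)))), x ∈ G := by
    refine (ae_map_iff (p := fun x => x ∈ G) measurable_pathMap.aemeasurable hGm).2 ?_
    exact hcan
  rw [← law_eq hZ] at h2
  exact ae_of_ae_map hm1.aemeasurable h2
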